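/- Let (Δ,Θ) be a directive bi-sequence with associated prefixes (w_n). For every n ≥ 0, at most two pseudopalindromic prefixes are missed between w_n and w_{n+1}; that is, there are at most two pseudopalindromic prefixes v of w_{n+1} satisfying |w_n| < |v| < |w_{n+1}|. -/

import Mathlib

/-- The ternary alphabet. -/
abbrev Letter := Fin 3

/-- Finite words over the ternary alphabet. -/
abbrev Word := List Letter

/-- The four involutory antimorphisms of ternary words: the reversal `R`
and, for each letter `i`, the antimorphism `E i`. -/
inductive AM where
  | R : AM
  | E : Letter → AM
deriving DecidableEq

/-- The action of an antimorphism on a single letter: `R` fixes every letter,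
and `E i` fixes `i` and exchanges the other two letters (in `Fin 3`,
this involution is `a ↦ -(i + a)`). -/
def AM.letter : AM → Letter → Letter
  | .R, _a => _a
  | .E i, a => -(i + a)

/-- The action of an antimorphism on a word: letterwise image followed by reversal. -/
def AM.apply (t : AM) (w : Word) : Word := (w.map t.letter).reverse

/-- A word is a pseudopalindrome if it is a `ϑ`-palindrome for some
`ϑ ∈ {R, E_0, E_1, E_2}`. -/
def IsPseudopal (w : Word) : Prop := ∃ t : AM, t.apply w = w

/-- `v` is an image of `w` if `v = ϑ(w)` for some `ϑ ∈ {R, E_0, E_1, E_2}`. -/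
def IsImage (w v : Word) : Prop := ∃ t : AM, v = t.apply w

/-- `v` is the `ϑ`-palindromic closure of `u`: the shortest `ϑ`-palindrome
having `u` as a prefix. -/
def IsPalClosure (t : AM) (u v : Word) : Prop :=
  u <+: v ∧ t.apply v = v ∧
    ∀ v' : Word, u <+: v' → t.apply v' = v' → v.length ≤ v'.length

/-- `w` is the sequence of prefixes associated with the directive bi-sequence
`(Δ, Θ)`: `w 0 = ε` and `w (n+1) = (w n · δ_{n+1})^{ϑ_{n+1}}`. -/
def DirectivePrefixes (Δ : ℕ → Letter) (Θ : ℕ → AM) (w : ℕ → Word) : Prop :=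
  w 0 = [] ∧ ∀ n : ℕ, IsPalClosure (Θ (n + 1)) (w n ++ [Δ (n + 1)]) (w (n + 1))

/-- A pseudopalindromic prefix `v` of `w_{n+1}` is missed between `w_n` and `w_{n+1}`
if `|w_n| < |v| < |w_{n+1}|`. -/
def MissedBetween (wn wn1 v : Word) : Prop :=
  v <+: wn1 ∧ IsPseudopal v ∧ wn.length < v.length ∧ v.length < wn1.length

/-- An image of `u` occurs in `v` at (0-indexed) position `p`. -/
def OccursImageAt (u v : Word) (p : ℕ) : Prop :=
  p + u.length ≤ v.length ∧ IsImage u ((v.drop p).take u.length)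

/-- Assumption A for the pair `(wn, wn1)`: some image of `wn` occurs in `wn1`
at a position `p` with `0 < p < |wn1| - |wn|`, overlapping both the prefix
occurrence of `wn` and the suffix occurrence of an image of `wn`. -/
def AssumptionA (wn wn1 : Word) : Prop :=
  ∃ p : ℕ, 0 < p ∧ p < wn1.length - wn.length ∧ p < wn.length ∧
    wn1.length - wn.length < p + wn.length ∧ OccursImageAt wn wn1 p

/-- The prefix of length `n` of the directive bi-sequence is normalized:
every pseudopalindromic prefix of `w n` equals `w k` for some `k ≤ n`. -/
def NormalizedUpTo (w : ℕ → Word) (n : ℕ) : Prop :=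
  ∀ v : Word, v <+: w n → IsPseudopal v → ∃ k : ℕ, k ≤ n ∧ v = w k

/-- `rep u l` is the `l`-fold concatenation `u^l`. -/
def rep (u : Word) (l : ℕ) : Word := (List.replicate l u).flatten

/-- `rmSuf x y` is `x · y⁻¹`: the word `x` with its suffix of length `|y|` removed. -/
def rmSuf (x y : Word) : Word := x.take (x.length - y.length)

/-- `v` is a prefix of the infinite periodic word `pat^ω`. -/
def IsPrefixOfPow (pat v : Word) : Prop :=
  ∀ q : ℕ, ∀ hq : q < v.length, ∃ hp : q % pat.length < pat.length,
    v.get ⟨q, hq⟩ = pat.get ⟨q % pat.length, hp⟩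

theorem AM.letter_letter (t : AM) (a : Letter) : t.letter (t.letter a) = a := by
  cases t <;> simp [AM.letter]

theorem AM.apply_length (t : AM) (w : Word) : (t.apply w).length = w.length := by
  simp [AM.apply]

theorem AM.apply_append (t : AM) (x y : Word) : t.apply (x ++ y) = t.apply y ++ t.apply x := by
  simp [AM.apply]

theorem AM.apply_apply (t : AM) (w : Word) : t.apply (t.apply w) = w := by
  simp [AM.apply, Function.comp_def, AM.letter_letter]

/-- The prefix of length `l` of `u` is a `t`-palindrome iff the letters of `u` below `l`
are exchanged by `x ↦ l - 1 - x` up to `t`. -/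
theorem AM.apply_take_eq_iff (t : AM) {u : Word} {l : ℕ} (hl : l ≤ u.length) :
    t.apply (u.take l) = u.take l ↔
      ∀ x < l, u.getD (l - 1 - x) 0 = t.letter (u.getD x 0) := by
  have key : ∀ x, x < l → ((t.apply (u.take l))[x]? = some (t.letter (u.getD (l - 1 - x) 0)) ∧
      (u.take l)[x]? = some (u.getD x 0)) := by
    intro x hx
    have h1 : x < u.length := by omega
    have h2 : l - 1 - x < u.length := by omega
    constructor
    · simp [AM.apply, hl, hx, h2]
    · simp [hx, h1]
  constructor
  · intro h x hx
    have hk := key x hx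
    rw [h, hk.2] at hk
    rw [Option.some.inj hk.1, AM.letter_letter]
  · intro h
    apply List.ext_getElem?
    intro x
    by_cases hx : x < l
    · rw [(key x hx).1, (key x hx).2, h x hx, AM.letter_letter]
    · rw [List.getElem?_eq_none, List.getElem?_eq_none]
      · simp; omega
      · simp [AM.apply_length]; omega

/-- For four distinct antimorphisms, the letter permutations `s ∘ t₁`, `s ∘ t₂` and `s ∘ t₃` do not
pairwise commute on any letter. -/
theorem AM.not_pairwise_commute {s t₁ t₂ t₃ : AM} (h₁ : t₁ ≠ s) (h₂ : t₂ ≠ s) (h₃ : t₃ ≠ s)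
    (h₁₂ : t₁ ≠ t₂) (h₁₃ : t₁ ≠ t₃) (h₂₃ : t₂ ≠ t₃) (a : Letter)
    (c₁₂ : s.letter (t₁.letter (s.letter (t₂.letter a))) =
      s.letter (t₂.letter (s.letter (t₁.letter a))))
    (c₁₃ : s.letter (t₁.letter (s.letter (t₃.letter a))) =
      s.letter (t₃.letter (s.letter (t₁.letter a))))
    (c₂₃ : s.letter (t₂.letter (s.letter (t₃.letter a))) =
      s.letter (t₃.letter (s.letter (t₂.letter a)))) : False := by
  revert h₁ h₂ h₃ h₁₂ h₁₃ h₂₃ c₁₂ c₁₃ c₂₃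
  cases s <;> cases t₁ <;> cases t₂ <;> cases t₃ <;>
    simp only [AM.letter, ne_eq, AM.E.injEq, reduceCtorEq, not_true_eq_false, not_false_eq_true,
      false_implies, true_implies, implies_true] <;>
    decide +revert

theorem IsPalClosure.length_le {t : AM} {u v : Word} (h : IsPalClosure t u v) :
    v.length ≤ 2 * u.length := by
  have := h.2.2 (u ++ t.apply u) (List.prefix_append _ _)
    (by rw [AM.apply_append, AM.apply_apply])
  rw [List.length_append, AM.apply_length] at this
  omega

/-- No prefix of a palindromic closure of `u` that is at least as long as `u` and strictly shorter
than the closure is a palindrome for the same antimorphism. -/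
theorem IsPalClosure.apply_take_ne {t : AM} {u v : Word} (h : IsPalClosure t u v) {l : ℕ}
    (hu : u.length ≤ l) (hv : l < v.length) : t.apply (v.take l) ≠ v.take l := by
  intro hp
  have := h.2.2 (v.take l) (List.prefix_take_iff.2 ⟨h.1, hu⟩) hp
  rw [List.length_take] at this
  omega

/-- Two distinct proper prefixes of a palindromic closure of `u`, both at least as long as `u`, are
not palindromes for the same antimorphism. -/
theorem IsPalClosure.not_same_type {s : AM} {u v : Word} (h : IsPalClosure s u v) {t : AM}
    {i j : ℕ} (hu : u.length ≤ i) (hij : i < j) (hj : j < v.length)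
    (hi' : t.apply (v.take i) = v.take i) (hj' : t.apply (v.take j) = v.take j) : False := by
  have hM := h.length_le
  have hs : s.apply (v.take v.length) = v.take v.length := by simpa using h.2.1
  rw [AM.apply_take_eq_iff _ le_rfl] at hs
  rw [AM.apply_take_eq_iff _ (by omega)] at hi' hj'
  have low : ∀ x < i, v.getD (x + (j - i)) 0 = v.getD x 0 := by
    intro x hx
    have h1 := hi' x hx
    have h2 := hj' (x + (j - i)) (by omega)
    rw [show j - 1 - (x + (j - i)) = i - 1 - x by omega, h1] at h2
    simpa only [AM.letter_letter] using congrArg t.letter h2.symm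
  have period : ∀ x < v.length - (j - i), v.getD (x + (j - i)) 0 = v.getD x 0 := by
    intro x hx
    by_cases hxi : x < i
    · exact low x hxi
    · have h1 := low (v.length - 1 - (x + (j - i))) (by omega)
      rw [show v.length - 1 - (x + (j - i)) + (j - i) = v.length - 1 - x by omega,
        hs x (by omega), hs (x + (j - i)) (by omega)] at h1
      simpa only [AM.letter_letter] using congrArg s.letter h1.symm
  refine h.apply_take_ne (l := v.length - (j - i)) (by omega) (by omega) ?_
  rw [AM.apply_take_eq_iff _ (by omega)]
  intro x hx
  rw [← period x hx, ← hs (x + (j - i)) (by omega)]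
  congr 1
  omega

/-- Two pseudopalindromic proper prefixes of a palindrome `v` whose lengths sum to more than `|v|`
give commuting letter permutations at the first letter of `v`. -/
theorem AM.commute_of_pal_prefixes {s t₁ t₂ : AM} {v : Word} (hs : s.apply v = v) {i j : ℕ}
    (hi : i < v.length) (hj : j < v.length) (hij : v.length < i + j)
    (hi' : t₁.apply (v.take i) = v.take i) (hj' : t₂.apply (v.take j) = v.take j) :
    s.letter (t₁.letter (s.letter (t₂.letter (v.getD 0 0)))) =
      s.letter (t₂.letter (s.letter (t₁.letter (v.getD 0 0)))) := by
  have shift : ∀ {t : AM} {l : ℕ}, l < v.length → t.apply (v.take l) = v.take l →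
      ∀ x < l, v.getD (x + (v.length - l)) 0 = s.letter (t.letter (v.getD x 0)) := by
    intro t l hl ht x hx
    have hs' : s.apply (v.take v.length) = v.take v.length := by simpa using hs
    rw [AM.apply_take_eq_iff _ le_rfl] at hs'
    rw [AM.apply_take_eq_iff _ hl.le] at ht
    rw [← ht x hx, ← hs' (l - 1 - x) (by omega)]
    congr 1
    omega
  rw [← shift hj hj' 0 (by omega), ← shift hi hi' 0 (by omega),
    ← shift hi hi' _ (by omega), ← shift hj hj' _ (by omega)]
  congr 1
  omega

/-- Theorem: at most two pseudopalindromic prefixes are missed between `w n`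
and `w (n+1)`. -/
theorem at_most_two_missed_pseudopalindromic_prefixes
    (Δ : ℕ → Letter) (Θ : ℕ → AM) (w : ℕ → Word)
    (hw : DirectivePrefixes Δ Θ w) (n : ℕ) :
    ∀ v₁ v₂ v₃ : Word,
      MissedBetween (w n) (w (n + 1)) v₁ →
      MissedBetween (w n) (w (n + 1)) v₂ →
      MissedBetween (w n) (w (n + 1)) v₃ →
      v₁ = v₂ ∨ v₁ = v₃ ∨ v₂ = v₃ := by
  intro v₁ v₂ v₃ ⟨p₁, ⟨t₁, q₁⟩, a₁, b₁⟩ ⟨p₂, ⟨t₂, q₂⟩, a₂, b₂⟩ ⟨p₃, ⟨t₃, q₃⟩, a₃, b₃⟩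
  by_contra! hne
  obtain ⟨h₁₂, h₁₃, h₂₃⟩ := hne
  have hc := hw.2 n
  have hlen := hc.length_le
  have hu : (w n ++ [Δ (n + 1)]).length = (w n).length + 1 := by simp
  have e₁ := List.prefix_iff_eq_take.1 p₁
  have e₂ := List.prefix_iff_eq_take.1 p₂
  have e₃ := List.prefix_iff_eq_take.1 p₃
  rw [e₁] at q₁
  rw [e₂] at q₂
  rw [e₃] at q₃
  have l₁₂ : v₁.length ≠ v₂.length := fun h => h₁₂ (by rw [e₁, e₂, h])
  have l₁₃ : v₁.length ≠ v₃.length := fun h => h₁₃ (by rw [e₁, e₃, h])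
  have l₂₃ : v₂.length ≠ v₃.length := fun h => h₂₃ (by rw [e₂, e₃, h])
  have type_ne : ∀ {t t' : AM} {i j : ℕ}, (w n).length < i → i < (w (n + 1)).length →
      (w n).length < j → j < (w (n + 1)).length → i ≠ j →
      t.apply ((w (n + 1)).take i) = (w (n + 1)).take i →
      t'.apply ((w (n + 1)).take j) = (w (n + 1)).take j → t ≠ t' := by
    rintro t t' i j hi hi' hj hj' hij hti htj rfl
    rcases Nat.lt_or_gt_of_ne hij with h | h
    · exact hc.not_same_type (by omega) h hj' hti htj
    · exact hc.not_same_type (by omega) h hi' htj hti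
  have type_ne_closure : ∀ {t : AM} {i : ℕ}, (w n).length < i → i < (w (n + 1)).length →
      t.apply ((w (n + 1)).take i) = (w (n + 1)).take i → t ≠ Θ (n + 1) := by
    rintro t i hi hi' ht rfl
    exact hc.apply_take_ne (by omega) hi' ht
  exact AM.not_pairwise_commute (type_ne_closure a₁ b₁ q₁) (type_ne_closure a₂ b₂ q₂)
    (type_ne_closure a₃ b₃ q₃) (type_ne a₁ b₁ a₂ b₂ l₁₂ q₁ q₂) (type_ne a₁ b₁ a₃ b₃ l₁₃ q₁ q₃)
    (type_ne a₂ b₂ a₃ b₃ l₂₃ q₂ q₃) _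
    (AM.commute_of_pal_prefixes hc.2.1 b₁ b₂ (by omega) q₁ q₂)
    (AM.commute_of_pal_prefixes hc.2.1 b₁ b₃ (by omega) q₁ q₃)
    (AM.commute_of_pal_prefixes hc.2.1 b₂ b₃ (by omega) q₂ q₃)
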